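/- arXiv:1401.2422 — 3 statements merged into one kernel-verified Lean document; each statement's English description precedes it below -/
import Mathlib

section
/- Let r ≥ 1 and β be integers with 1 ≤ β ≤ r and β dividing r, let n = (r+β)(r+2)/2, and set b = r+β. Define the sequence e_1,…,e_b recursively by e_b = n and e_{m−1} = e_m − ⌈2 e_m / m⌉ + (r+1) for 2 ≤ m ≤ b. Then there exist subsets S_1, …, S_b of {1,…,n} such that: (a) |S_i| = r+1 for every i; (b) the union of all the S_i equals {1,…,n}; (c) |S_i ∩ S_j| ≤ 1 for all i ≠ j; (d) every element of {1,…,n} belongs to at most two of the sets S_i; (e) every S_i contains an element belonging to no other S_j; and (f) for every m ∈ {1,…,b}, the minimum over all subsets I of {1,…,b} with |I| = m of the cardinality of the union of the S_i for i ∈ I equals e_m. (Such sets are given by the Turán graph construction: the sets S_i are the closed stars of the b vertices of the Turán graph with b vertices partitioned into (r+β)/β parts of size β, with coordinates indexing the vertices and edges of the graph.) -/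
open Classical in
/-- The support of a vector: the set of coordinates where it is nonzero. -/
noncomputable def vsupp {F : Type*} [Field F] {n : ℕ} (v : Fin n → F) : Finset (Fin n) :=
  Finset.univ.filter (fun i => v i ≠ 0)

open Classical in
/-- The support of a subspace: the union of the supports of its vectors. -/
noncomputable def codeSupp {F : Type*} [Field F] {n : ℕ}
    (D : Submodule F (Fin n → F)) : Finset (Fin n) :=
  Finset.univ.filter (fun i => ∃ v ∈ D, v i ≠ 0)

/-- The dual code w.r.t. the standard bilinear form `⟨x,y⟩ = ∑ x i * y i`. -/
def dualCode {F : Type*} [Field F] {n : ℕ} (C : Submodule F (Fin n → F)) :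
    Submodule F (Fin n → F) where
  carrier := {w | ∀ v ∈ C, ∑ i, v i * w i = 0}
  zero_mem' := by intro v _; simp
  add_mem' := by
    intro a b ha hb v hv
    have h : ∑ i, v i * (a + b) i = (∑ i, v i * a i) + ∑ i, v i * b i := by
      simp [mul_add, Finset.sum_add_distrib]
    rw [h, ha v hv, hb v hv, add_zero]
  smul_mem' := by
    intro c a ha v hv
    have h : ∑ i, v i * (c • a) i = c * ∑ i, v i * a i := by
      simp [Finset.mul_sum, mul_left_comm]
    rw [h, ha v hv, mul_zero]

/-- The `i`-th generalized Hamming weight (1-indexed): the minimum support cardinality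
of an `i`-dimensional subspace. -/
noncomputable def ghw {F : Type*} [Field F] {n : ℕ} (C : Submodule F (Fin n → F)) (i : ℕ) : ℕ :=
  sInf {s | ∃ D : Submodule F (Fin n → F), D ≤ C ∧ Module.finrank F D = i ∧ (codeSupp D).card = s}

/-- The set of gaps of a code: elements of `{1,…,n}` that are not generalized Hamming weights. -/
noncomputable def gapSet {F : Type*} [Field F] {n : ℕ} (C : Submodule F (Fin n → F)) : Finset ℕ :=
  (Finset.Icc 1 n) \ ((Finset.Icc 1 (Module.finrank F C)).image (ghw C))

/-- The `i`-th gap of a code (1-indexed), via the increasing enumeration of the gap set. -/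
noncomputable def gapNum {F : Type*} [Field F] {n : ℕ} (C : Submodule F (Fin n → F)) (i : ℕ) : ℕ :=
  ((gapSet C).sort (· ≤ ·)).getD (i - 1) 0

/-- The minimum distance of a code: the minimum Hamming weight of a nonzero codeword. -/
noncomputable def dmin {F : Type*} [Field F] {n : ℕ} (C : Submodule F (Fin n → F)) : ℕ :=
  sInf {w | ∃ v ∈ C, v ≠ 0 ∧ (vsupp v).card = w}

/-- `S` is an `ℓ`-core (`ℓ = S.card`) of `B` if no nonzero codeword of `B`
has its support contained in `S`. -/
def isCore {F : Type*} [Field F] {n : ℕ} (B : Submodule F (Fin n → F)) (S : Finset (Fin n)) : Prop :=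
  ∀ v ∈ B, v ≠ 0 → ¬ (vsupp v ⊆ S)

/-- The subspace of the dual code spanned by all its codewords of Hamming weight `≤ r+1`. -/
noncomputable def lowWtSpan {F : Type*} [Field F] {n : ℕ}
    (C : Submodule F (Fin n → F)) (r : ℕ) : Submodule F (Fin n → F) :=
  Submodule.span F {c | c ∈ dualCode C ∧ (vsupp c).card ≤ r + 1}

/-- `A_i`: the set of local parities covering coordinate `i`, i.e. dual codewords of
Hamming weight at most `r+1` whose support contains `i`. -/
def coveringParities {F : Type*} [Field F] {n : ℕ}
    (C : Submodule F (Fin n → F)) (r : ℕ) (i : Fin n) : Set (Fin n → F) :=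
  {c | c ∈ dualCode C ∧ (vsupp c).card ≤ r + 1 ∧ c i ≠ 0}

/-- `C` is locally 2-reconstructible with locality `r`: every `A_i` is nonempty
and `A_i ≠ A_j` for `i ≠ j`. -/
def Locally2Recon {F : Type*} [Field F] {n : ℕ}
    (C : Submodule F (Fin n → F)) (r : ℕ) : Prop :=
  (∀ i : Fin n, (coveringParities C r i).Nonempty) ∧
  (∀ i j : Fin n, i ≠ j → coveringParities C r i ≠ coveringParities C r j)

open Finset in
/-- The closed star of a vertex, with the vertex `v` encoded as the loop `s(v, v)`. -/
def closedStar {V : Type*} [Fintype V] [DecidableEq V] (G : SimpleGraph V) [DecidableRel G.Adj]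
    (v : V) : Finset (Sym2 V) :=
  (insert v (G.neighborFinset v)).image (fun w => s(v, w))

section ClosedStar

open Finset

variable {V : Type*} [Fintype V] [DecidableEq V] (G : SimpleGraph V) [DecidableRel G.Adj]

lemma mk_mem_closedStar {u v w : V} :
    s(v, w) ∈ closedStar G u ↔ (u = v ∨ u = w) ∧ (v = w ∨ G.Adj v w) := by
  simp only [closedStar, mem_image, mem_insert, SimpleGraph.mem_neighborFinset, Sym2.eq_iff]
  constructor
  · rintro ⟨a, h, ⟨rfl, rfl⟩ | ⟨rfl, rfl⟩⟩
    · exact ⟨Or.inl rfl, h.imp Eq.symm id⟩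
    · exact ⟨Or.inr rfl, h.imp id (fun h => h.symm)⟩
  · rintro ⟨rfl | rfl, h⟩
    · exact ⟨w, h.imp Eq.symm id, Or.inl ⟨rfl, rfl⟩⟩
    · exact ⟨v, h.imp id (fun h => h.symm), Or.inr ⟨rfl, rfl⟩⟩

lemma card_closedStar (v : V) : (closedStar G v).card = G.degree v + 1 := by
  rw [closedStar, card_image_of_injective _ (fun _ _ => Sym2.congr_right.1),
    card_insert_of_notMem (by simp), SimpleGraph.card_neighborFinset_eq_degree]

lemma closedStar_inter_biUnion {v : V} {I : Finset V} (hv : v ∉ I) :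
    closedStar G v ∩ I.biUnion (closedStar G) =
      (I.filter (G.Adj v)).image (fun w => s(v, w)) := by
  ext p
  induction p using Sym2.ind with
  | _ a c =>
    simp only [mem_inter, mem_biUnion, mk_mem_closedStar, mem_image, mem_filter, Sym2.eq_iff]
    constructor
    · rintro ⟨⟨rfl | rfl, h⟩, w, hw, rfl | rfl, -⟩
      · exact absurd hw hv
      · exact ⟨w, ⟨hw, h.resolve_left (by rintro rfl; exact hv hw)⟩, Or.inl ⟨rfl, rfl⟩⟩
      · exact ⟨w, ⟨hw, (h.resolve_left (by rintro rfl; exact hv hw)).symm⟩, Or.inr ⟨rfl, rfl⟩⟩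
      · exact absurd hw hv
    · rintro ⟨w, ⟨hw, h⟩, ⟨rfl, rfl⟩ | ⟨rfl, rfl⟩⟩
      · exact ⟨⟨Or.inl rfl, Or.inr h⟩, w, hw, Or.inr rfl, Or.inr h⟩
      · exact ⟨⟨Or.inr rfl, Or.inr h.symm⟩, w, hw, Or.inl rfl, Or.inr h.symm⟩

lemma card_biUnion_closedStar_insert {v : V} {I : Finset V} (hv : v ∉ I) :
    ((insert v I).biUnion (closedStar G)).card + (I.filter (G.Adj v)).card =
      (I.biUnion (closedStar G)).card + (G.degree v + 1) := by
  have h := card_union_add_card_inter (closedStar G v) (I.biUnion (closedStar G))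
  rw [closedStar_inter_biUnion G hv,
    card_image_of_injective _ (fun _ _ => Sym2.congr_right.1), card_closedStar] at h
  rw [biUnion_insert]
  omega

lemma closedStar_inter_card_le_one {u v : V} (h : u ≠ v) :
    (closedStar G u ∩ closedStar G v).card ≤ 1 := by
  refine (card_le_card (t := {s(u, v)}) ?_).trans (card_singleton _).le
  intro p
  induction p using Sym2.ind with
  | _ a c =>
    simp only [mem_inter, mk_mem_closedStar, mem_singleton, Sym2.eq_iff]
    grind

lemma card_filter_mem_closedStar_le_two (p : Sym2 V) :
    (univ.filter (fun v => p ∈ closedStar G v)).card ≤ 2 := by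
  induction p using Sym2.ind with
  | _ a c =>
    refine (card_le_card (t := {a, c}) ?_).trans card_le_two
    intro v
    simp only [mem_filter, mk_mem_closedStar, mem_insert, mem_singleton]
    tauto

end ClosedStar

section TuranCount

open Finset SimpleGraph

lemma two_mul_sum_range_div {x : ℕ} (hx : 0 < x) (k s : ℕ) (hs : s ≤ x) :
    2 * ∑ i ∈ range (x * k + s), i / x + k * x = k * (x * k + 2 * s) := by
  induction k generalizing s with
  | zero =>
    have : ∑ i ∈ range (x * 0 + s), i / x = 0 :=
      sum_eq_zero fun i hi => Nat.div_eq_of_lt (by have := mem_range.1 hi; omega)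
    rw [this]
    simp
  | succ k ih =>
    induction s with
    | zero =>
      have := ih x le_rfl
      rw [mul_add_one, add_zero]
      linarith
    | succ s ihs =>
      have h := ihs (by omega)
      have hd : (x * (k + 1) + s) / x = k + 1 := by
        rw [Nat.mul_add_div hx, Nat.div_eq_of_lt (by omega), add_zero]
      rw [← add_assoc, sum_range_succ, hd]
      linarith

/-- The number of edges of the Turán graph on `m` vertices with `x` parts. -/
def turanEdges (x m : ℕ) : ℕ := ∑ k ∈ range m, (k - k / x)

lemma turanEdges_succ (x m : ℕ) : turanEdges x (m + 1) = turanEdges x m + (m - m / x) :=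
  sum_range_succ _ _

lemma two_mul_turanEdges {x : ℕ} (m : ℕ) :
    2 * turanEdges x m + 2 * ∑ k ∈ range m, k / x + m = m * m := by
  induction m with
  | zero => simp [turanEdges]
  | succ m ih =>
    rw [turanEdges_succ, sum_range_succ]
    have := Nat.div_le_self m x
    obtain ⟨d, hd⟩ := Nat.exists_eq_add_of_le this
    have : m - m / x = d := by omega
    rw [this]
    nlinarith

lemma two_mul_turanEdges_mul {x : ℕ} (hx : 0 < x) (k : ℕ) :
    2 * turanEdges x (x * k) + x * k * k = x * k * (x * k) := by
  have h₁ := two_mul_turanEdges (x := x) (x * k)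
  have h₂ := two_mul_sum_range_div hx k 0 (Nat.zero_le _)
  rw [add_zero] at h₂
  linarith

/-- The floor of the average degree of a Turán graph is its minimum degree. -/
lemma ceil_two_mul_div_turanEdges {x : ℕ} (hx : 0 < x) (m : ℕ) (d : ℤ) :
    ⌈2 * (((m + 1 : ℕ) * d - turanEdges x (m + 1) : ℤ) : ℚ) / ((m + 1 : ℕ) : ℚ)⌉ =
      2 * d - (m - m / x : ℕ) := by
  have hm := Nat.div_add_mod m x
  have hs := Nat.mod_lt m hx
  have h₁ := two_mul_turanEdges (x := x) (m + 1)
  have h₂ := two_mul_sum_range_div hx (m / x) (m % x + 1) hs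
  rw [← add_assoc, hm] at h₂
  have hle := Nat.div_le_self m x
  set W := ∑ k ∈ range (m + 1), k / x
  set t := turanEdges x (m + 1)
  generalize m / x = k at *
  generalize m % x = s at *
  obtain ⟨y, rfl⟩ : ∃ y, x = s + 1 + y := Nat.exists_eq_add_of_le hs
  rw [Int.ceil_eq_iff, lt_div_iff₀ (by positivity), div_le_iff₀ (by positivity)]
  have hT : (2 * t : ℤ) = (m + 1) * m - k * (m + 1) + k * y := by
    zify at h₁ h₂ hm
    linear_combination h₁ - h₂ - k * hm
  have hky : (k * y : ℤ) < m + 1 := by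
    zify at hm
    nlinarith [mul_nonneg (Int.natCast_nonneg k) (Int.natCast_nonneg s)]
  have hky' : (0 : ℤ) ≤ k * y := by positivity
  constructor
  · have : ((2 * d - (m - k : ℕ) - 1) * (m + 1) : ℤ) < 2 * ((m + 1) * d - t) := by
      push_cast [hle]
      linarith
    exact_mod_cast this
  · have : 2 * ((m + 1) * d - t) ≤ ((2 * d - (m - k : ℕ)) * (m + 1) : ℤ) := by
      push_cast [hle]
      linarith
    exact_mod_cast this

lemma eq_sub_turanEdges_of_rec {x b : ℕ} (hx : 0 < x) (r : ℕ) (e : ℕ → ℤ)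
    (heb : e b = b * (r + 1 : ℤ) - turanEdges x b)
    (herec : ∀ m, 2 ≤ m → m ≤ b →
      e (m - 1) = e m - ⌈(2 * (e m : ℚ)) / (m : ℚ)⌉ + (r + 1))
    {m : ℕ} (hm : 1 ≤ m) (hmb : m ≤ b) :
    e m = m * (r + 1 : ℤ) - turanEdges x m := by
  induction hmb using Nat.decreasingInduction with
  | self => exact heb
  | of_succ k hk ih =>
    have h := herec (k + 1) (by omega) (by omega)
    rw [ih (by omega), ceil_two_mul_div_turanEdges hx, turanEdges_succ, Nat.add_sub_cancel] at h
    rw [h]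
    push_cast
    ring

lemma card_filter_val_mod_eq {b : ℕ} (x m v : ℕ) (hx : 0 < x) (hm : m ≤ b) :
    ((univ.filter (fun j : Fin b => j.val < m)).filter (fun j => j.val % x = v % x)).card =
      m / x + if v % x < m % x then 1 else 0 := by
  rw [← Nat.count_modEq_card m hx v, Nat.count_eq_card_filter_range,
    ← card_map Fin.valEmbedding]
  congr 1
  ext j
  simp only [mem_map, mem_filter, mem_univ, true_and, Fin.valEmbedding_apply, mem_range]
  constructor
  · rintro ⟨j, h, rfl⟩
    exact h
  · rintro ⟨h, h'⟩
    exact ⟨⟨j, by omega⟩, ⟨h, h'⟩, rfl⟩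

lemma card_filter_turanGraph_adj {b x : ℕ} (v : Fin b) (I : Finset (Fin b)) :
    (I.filter (fun j => j.val % x = v.val % x)).card +
      (I.filter ((turanGraph b x).Adj v)).card = I.card := by
  rw [← card_filter_add_card_filter_not (s := I) (fun j => j.val % x = v.val % x)]
  simp only [turanGraph_adj, ne_eq, eq_comm]

lemma turanGraph_degree {b x k : ℕ} (hx : 0 < x) (hb : b = x * k) (v : Fin b) :
    k + (turanGraph b x).degree v = b := by
  have h := card_filter_val_mod_eq x b v.val hx le_rfl
  rw [filter_true_of_mem (p := fun j : Fin b => j.val < b) (fun j _ => j.isLt)] at h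
  have h' := card_filter_turanGraph_adj (x := x) v univ
  have hmod : b % x = 0 := by rw [hb, Nat.mul_mod_right]
  have hdiv : b / x = k := by rw [hb, Nat.mul_div_cancel_left _ hx]
  rwa [h, hmod, hdiv, if_neg (Nat.not_lt_zero _), add_zero, card_univ, Fintype.card_fin,
    ← neighborFinset_eq_filter,
    card_neighborFinset_eq_degree] at h'

/-- Removing a vertex in a largest part shows that at most `turanEdges` edges are spanned. -/
lemma le_card_biUnion_closedStar_turanGraph {b x r : ℕ} (hx : 0 < x)
    (hdeg : ∀ v, (turanGraph b x).degree v = r) (m : ℕ) (I : Finset (Fin b)) (hI : I.card = m) :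
    m * (r + 1) ≤ (I.biUnion (closedStar (turanGraph b x))).card + turanEdges x m := by
  induction m generalizing I with
  | zero => simp
  | succ m ih =>
    obtain ⟨y, -, hy⟩ := exists_lt_card_fiber_of_mul_lt_card_of_maps_to
      (s := I) (t := range x) (f := fun j => j.val % x) (n := m / x)
      (fun j _ => mem_range.2 (Nat.mod_lt _ hx))
      (by rw [card_range, hI]; exact Nat.lt_succ_of_le (Nat.mul_div_le m x))
    obtain ⟨v, hv⟩ := card_pos.1 (Nat.zero_lt_of_lt hy)
    obtain ⟨hvI, rfl⟩ := mem_filter.1 hv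
    have h₁ := card_biUnion_closedStar_insert (turanGraph b x) (notMem_erase v I)
    have h₂ := card_filter_turanGraph_adj (x := x) v I
    have h₃ : ((I.erase v).filter ((turanGraph b x).Adj v)).card =
        (I.filter ((turanGraph b x).Adj v)).card := by
      congr 1
      ext w
      simp only [mem_filter, mem_erase]
      exact ⟨fun h => ⟨h.1.2, h.2⟩, fun h => ⟨⟨h.2.ne', h.1⟩, h.2⟩⟩
    have h₄ := ih (I.erase v) (by rw [card_erase_of_mem hvI, hI, Nat.add_sub_cancel])
    rw [insert_erase hvI, h₃, hdeg] at h₁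
    rw [turanEdges_succ, add_mul, one_mul]
    omega

lemma card_biUnion_closedStar_turanGraph_initial {b x r : ℕ} (hx : 0 < x)
    (hdeg : ∀ v, (turanGraph b x).degree v = r) (m : ℕ) (hm : m ≤ b) :
    ((univ.filter (fun j : Fin b => j.val < m)).biUnion (closedStar (turanGraph b x))).card +
      turanEdges x m = m * (r + 1) := by
  induction m with
  | zero => simp [turanEdges]
  | succ m ih =>
    have hins : univ.filter (fun j : Fin b => j.val < m + 1) =
        insert ⟨m, hm⟩ (univ.filter (fun j : Fin b => j.val < m)) := by
      ext j
      simp only [mem_filter, mem_univ, true_and, mem_insert, Fin.ext_iff]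
      omega
    have h₁ := card_biUnion_closedStar_insert (turanGraph b x)
      (v := ⟨m, hm⟩) (I := univ.filter (fun j : Fin b => j.val < m)) (by simp)
    have h₂ := card_filter_turanGraph_adj (x := x) ⟨m, hm⟩
      (univ.filter (fun j : Fin b => j.val < m))
    rw [card_filter_val_mod_eq x m m hx (by omega), if_neg (lt_irrefl _), add_zero,
      Fin.card_filter_val_lt, min_eq_right (by omega)] at h₂
    have h₃ := ih (by omega)
    rw [← hins, hdeg] at h₁
    rw [turanEdges_succ, add_mul, one_mul]
    omega

lemma sInf_card_biUnion_closedStar_turanGraph {b x r : ℕ} (hx : 0 < x)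
    (hdeg : ∀ v, (turanGraph b x).degree v = r) {m : ℕ} (hm : m ≤ b) :
    sInf {c : ℕ | ∃ I : Finset (Fin b), I.card = m ∧
      (I.biUnion (closedStar (turanGraph b x))).card = c} + turanEdges x m = m * (r + 1) := by
  set A := {c : ℕ | ∃ I : Finset (Fin b), I.card = m ∧
      (I.biUnion (closedStar (turanGraph b x))).card = c}
  have hmem : ((univ.filter (fun j : Fin b => j.val < m)).biUnion
      (closedStar (turanGraph b x))).card ∈ A :=
    ⟨_, by rw [Fin.card_filter_val_lt, min_eq_right hm], rfl⟩
  obtain ⟨I, hI, hI'⟩ := Nat.sInf_mem ⟨_, hmem⟩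
  have h₁ := Nat.sInf_le hmem
  have h₂ := card_biUnion_closedStar_turanGraph_initial hx hdeg m hm
  have h₃ := le_card_biUnion_closedStar_turanGraph hx hdeg m I hI
  omega

end TuranCount

/-- Theorem 5, Turán graph construction: for `β | r`, `1 ≤ β ≤ r`,
`n = (r+β)(r+2)/2` and `b = r+β`, there exist sets `S_1,…,S_b ⊆ {1,…,n}` of size `r+1`
covering everything, pairwise intersecting in at most one point, with each point in at
most two sets, each set having a private point, and whose minimal `m`-fold union sizes
achieve `e_m` exactly. -/
theorem stmt12 {r β n b : ℕ} (hr : 1 ≤ r) (hβ1 : 1 ≤ β) (hβr : β ≤ r) (hdvd : β ∣ r)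
    (hn : 2 * n = (r + β) * (r + 2)) (hb : b = r + β)
    (e : ℕ → ℤ) (heb : e b = n)
    (herec : ∀ m, 2 ≤ m → m ≤ b →
      e (m - 1) = e m - ⌈(2 * (e m : ℚ)) / (m : ℚ)⌉ + (r + 1)) :
    ∃ S : Fin b → Finset (Fin n),
      (∀ i, (S i).card = r + 1) ∧
      (Finset.univ.biUnion S = Finset.univ) ∧
      (∀ i j, i ≠ j → (S i ∩ S j).card ≤ 1) ∧
      (∀ x : Fin n, (Finset.univ.filter (fun i => x ∈ S i)).card ≤ 2) ∧
      (∀ i, ∃ x ∈ S i, ∀ j, j ≠ i → x ∉ S j) ∧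
      (∀ m, 1 ≤ m → m ≤ b →
        ((sInf {c : ℕ | ∃ I : Finset (Fin b), I.card = m ∧ (I.biUnion S).card = c} : ℕ) : ℤ) = e m) := by
  have hx : 0 < r / β + 1 := Nat.succ_pos _
  have hbx : b = (r / β + 1) * β := by rw [add_mul, Nat.div_mul_cancel hdvd, one_mul, hb]
  generalize r / β + 1 = x at hx hbx
  have hdeg : ∀ v, (SimpleGraph.turanGraph b x).degree v = r := fun v => by
    have := turanGraph_degree hx hbx v
    omega
  have hnb : n + turanEdges x b = b * (r + 1) := by
    have h := two_mul_turanEdges_mul hx β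
    rw [← hbx] at h
    have : b * b = b * r + b * β := by rw [← mul_add, ← hb]
    rw [← hb] at hn
    linarith
  have hcard : (Finset.univ.biUnion (closedStar (SimpleGraph.turanGraph b x))).card = n := by
    have h := card_biUnion_closedStar_turanGraph_initial hx hdeg b le_rfl
    rw [Finset.filter_true_of_mem (p := fun j : Fin b => j.val < b) (fun j _ => j.isLt)] at h
    omega
  let φ := (Finset.equivFinOfCardEq hcard).symm
  let S : Fin b → Finset (Fin n) := fun i =>
    Finset.univ.filter fun k => (φ k : Sym2 (Fin b)) ∈ closedStar (SimpleGraph.turanGraph b x) i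
  let ψ : Fin n ↪ Sym2 (Fin b) := φ.toEmbedding.trans (Function.Embedding.subtype _)
  have hmemS : ∀ i k, k ∈ S i ↔ ψ k ∈ closedStar (SimpleGraph.turanGraph b x) i := fun i k => by
    simp [S, ψ]
  have hsurj : ∀ i, ∀ p ∈ closedStar (SimpleGraph.turanGraph b x) i, ∃ k, ψ k = p := fun i p hp =>
    ⟨φ.symm ⟨p, Finset.mem_biUnion.2 ⟨i, Finset.mem_univ _, hp⟩⟩, by simp [ψ]⟩
  have hmap : ∀ I : Finset (Fin b),
      (I.biUnion S).map ψ = I.biUnion (closedStar (SimpleGraph.turanGraph b x)) := by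
    intro I
    ext p
    simp only [Finset.mem_map, Finset.mem_biUnion, hmemS]
    constructor
    · rintro ⟨k, h, rfl⟩
      exact h
    · rintro ⟨i, hi, hp⟩
      obtain ⟨k, rfl⟩ := hsurj i p hp
      exact ⟨k, ⟨i, hi, hp⟩, rfl⟩
  have hmapS : ∀ i, (S i).map ψ = closedStar (SimpleGraph.turanGraph b x) i := fun i => by
    simpa using hmap {i}
  refine ⟨S, fun i => ?_, ?_, fun i j hij => ?_, fun k => ?_, fun i => ?_, fun m hm hmb => ?_⟩
  · rw [← Finset.card_map ψ, hmapS, card_closedStar, hdeg]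
  · rw [← Finset.card_eq_iff_eq_univ, ← Finset.card_map ψ, hmap, hcard, Fintype.card_fin]
  · rw [← Finset.card_map ψ, Finset.map_inter, hmapS, hmapS]
    exact closedStar_inter_card_le_one _ hij
  · simp only [hmemS]
    exact card_filter_mem_closedStar_le_two _ (ψ k)
  · obtain ⟨k, hk⟩ := hsurj i s(i, i) ((mk_mem_closedStar _).2 ⟨Or.inl rfl, Or.inl rfl⟩)
    refine ⟨k, ?_, fun j hj => ?_⟩
    · rw [hmemS, hk, mk_mem_closedStar]
      simp
    · rw [hmemS, hk, mk_mem_closedStar]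
      simp [hj]
  · have h := sInf_card_biUnion_closedStar_turanGraph hx hdeg hmb
    simp only [← hmap, Finset.card_map] at h
    have heb' : e b = b * (r + 1 : ℤ) - turanEdges x b := by
      rw [heb]
      zify at hnb
      linarith
    rw [eq_sub_turanEdges_of_rec hx r e heb' herec hm hmb]
    exact eq_sub_of_add_eq (by exact_mod_cast h)
end

section
/- Let D be an [n,t] linear code over a field F with basis v_1, …, v_t, and let R_i denote the support of v_i. Suppose that: (a) |R_i ∩ R_j| ≤ 1 for all i ≠ j; (b) every coordinate ℓ ∈ {1,…,n} belongs to at most two of the sets R_i; and (c) every R_i contains at least one coordinate belonging to no other R_j. Then for every 1 ≤ m ≤ t, the m-th generalized Hamming weight of D equals the minimum, over all subsets I of {1,…,t} with |I| = m, of the cardinality of the union of the sets R_i for i ∈ I. -/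
theorem mem_vsupp {F : Type*} [Field F] {n : ℕ} {v : Fin n → F} {ℓ : Fin n} :
    ℓ ∈ vsupp v ↔ v ℓ ≠ 0 := by
  simp [vsupp]

theorem mem_codeSupp {F : Type*} [Field F] {n : ℕ} {D : Submodule F (Fin n → F)} {ℓ : Fin n} :
    ℓ ∈ codeSupp D ↔ ∃ w ∈ D, w ℓ ≠ 0 := by
  simp [codeSupp]

/-- The support of a span is contained in the union of the supports of the generators. -/
theorem codeSupp_span_image_subset {F : Type*} [Field F] {n t : ℕ} (v : Fin t → Fin n → F)
    (I : Finset (Fin t)) :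
    codeSupp (Submodule.span F (v '' I)) ⊆ I.biUnion (fun i => vsupp (v i)) := by
  intro ℓ hℓ
  obtain ⟨w, hw, hne⟩ := mem_codeSupp.1 hℓ
  by_contra hU
  have hle : Submodule.span F (v '' I) ≤ LinearMap.ker (LinearMap.proj (R := F) ℓ) := by
    rw [Submodule.span_le]
    rintro _ ⟨i, hi, rfl⟩
    by_contra h
    exact hU (Finset.mem_biUnion.2 ⟨i, hi, mem_vsupp.2 h⟩)
  exact hne (hle hw)

/-- A family of functionals with trivial common kernel contains a basis of the dual space. -/
theorem exists_finset_linearIndependent_of_iInf_ker_eq_bot {F E ι : Type*} [Field F]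
    [AddCommGroup E] [Module F E] [FiniteDimensional F E] [Finite ι]
    (x : ι → E →ₗ[F] F) (hx : ⨅ i, LinearMap.ker (x i) = ⊥) :
    ∃ I : Finset ι, I.card = Module.finrank F E ∧ LinearIndependent F (fun i : I => x i) := by
  classical
  obtain ⟨κ, a, ha, hspan, hLI⟩ := exists_linearIndependent' F x
  have : Finite κ := Finite.of_injective a ha
  have := Fintype.ofFinite κ
  have htop : Submodule.span F (Set.range (x ∘ a)) = ⊤ := by
    rw [hspan, eq_top_iff]
    intro K _
    exact mem_span_of_iInf_ker_le_ker (hx.le.trans bot_le)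
  have hcard : Fintype.card κ = Module.finrank F E := by
    rw [← finrank_span_eq_card hLI, htop, finrank_top]
    exact Subspace.dual_finrank_eq
  refine ⟨Finset.univ.image a, ?_, ?_⟩
  · rw [Finset.card_image_of_injective _ ha, Finset.card_univ, hcard]
  · have h := (linearIndepOn_range_iff ha x).2 hLI
    rw [← Set.image_univ, ← Finset.coe_univ, ← Finset.coe_image] at h
    exact h

/-- Every subcode `E` of the span of the `v i` admits `finrank E` generators, the union of whose
supports is no larger than the support of `E`. -/
theorem exists_card_biUnion_vsupp_le_card_codeSupp {F : Type*} [Field F] {n t : ℕ}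
    (v : Fin t → Fin n → F) (hli : LinearIndependent F v)
    (hinter : ∀ i j, i ≠ j → (vsupp (v i) ∩ vsupp (v j)).card ≤ 1)
    (htwo : ∀ ℓ : Fin n, (Finset.univ.filter (fun i => ℓ ∈ vsupp (v i))).card ≤ 2)
    (hpriv : ∀ i, ∃ ℓ ∈ vsupp (v i), ∀ j, j ≠ i → ℓ ∉ vsupp (v j))
    (E : Submodule F (Fin n → F)) (hE : E ≤ Submodule.span F (Set.range v)) :
    ∃ I : Finset (Fin t), I.card = Module.finrank F E ∧
      (I.biUnion (fun i => vsupp (v i))).card ≤ (codeSupp E).card := by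
  classical
  let x : Fin t → E →ₗ[F] F := fun i =>
    Finsupp.lapply i ∘ₗ hli.repr ∘ₗ Submodule.inclusion hE
  have hsum (w : E) (ℓ : Fin n) : (w : Fin n → F) ℓ = ∑ i, x i w * v i ℓ := by
    have h := hli.linearCombination_repr (Submodule.inclusion hE w)
    rw [Finsupp.linearCombination_apply, Finsupp.sum_fintype _ _ (by simp)] at h
    have h' := congrFun h ℓ
    simpa [x] using h'.symm
  have hker : ⨅ i, LinearMap.ker (x i) = ⊥ := by
    rw [eq_bot_iff]
    intro w hw
    rw [Submodule.mem_iInf] at hw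
    rw [Submodule.mem_bot]
    ext ℓ
    rw [hsum]
    exact Finset.sum_eq_zero fun i _ => by rw [LinearMap.mem_ker.1 (hw i), zero_mul]
  obtain ⟨I, hI, hLI⟩ := exists_finset_linearIndependent_of_iInf_ker_eq_bot x hker
  have hne : ∀ i ∈ I, x i ≠ 0 := fun i hi => hLI.ne_zero ⟨i, hi⟩
  have hpar : ∀ i ∈ I, ∀ j ∈ I, ∀ c d : F, c ≠ 0 → c • x i = d • x j → i = j :=
    fun i hi j hj c d hc h => congrArg Subtype.val
      (hLI.eq_of_smul_apply_eq_smul_apply c d ⟨i, hi⟩ ⟨j, hj⟩ hc h)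
  refine ⟨I, hI, ?_⟩
  rcases isEmpty_or_nonempty (Fin t) with _ | _
  · simp [Finset.eq_empty_of_isEmpty I]
  set U := I.biUnion (fun i => vsupp (v i)) with hU
  choose q hq hq' using hpriv
  -- A coordinate of `U` missing from `codeSupp E` is shared by two generators whose coordinate
  -- functionals are proportional on `E`.
  have key : ∀ ℓ ∈ U \ codeSupp E, ∃ i ∈ I, ∃ j, j ≠ i ∧ v i ℓ ≠ 0 ∧ v j ℓ ≠ 0 ∧
      v i ℓ • x i = (-v j ℓ) • x j := by
    intro ℓ hℓ
    rw [Finset.mem_sdiff, hU, Finset.mem_biUnion] at hℓ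
    obtain ⟨⟨i, hi, hiℓ⟩, hC⟩ := hℓ
    have hzero (w : E) : ∑ k, x k w * v k ℓ = 0 := by
      rw [← hsum]
      by_contra h
      exact hC (mem_codeSupp.2 ⟨w, w.2, h⟩)
    have hiℓ' := mem_vsupp.1 hiℓ
    have hj : ∃ j, j ≠ i ∧ v j ℓ ≠ 0 := by
      by_contra! h
      refine hne i hi (LinearMap.ext fun w => ?_)
      have h0 := hzero w
      rw [Finset.sum_eq_single i (fun k _ hk => by rw [h k hk, mul_zero]) (by simp)] at h0
      simpa [hiℓ'] using h0
    obtain ⟨j, hji, hjℓ⟩ := hj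
    refine ⟨i, hi, j, hji, hiℓ', hjℓ, LinearMap.ext fun w => ?_⟩
    have hoff (k : Fin t) (hk : k ≠ i ∧ k ≠ j) : v k ℓ = 0 := by
      by_contra hkℓ
      have hsub : ({i, j, k} : Finset (Fin t)) ⊆
          Finset.univ.filter (fun i => ℓ ∈ vsupp (v i)) := by
        intro a ha
        simp only [Finset.mem_insert, Finset.mem_singleton] at ha
        rw [Finset.mem_filter, mem_vsupp]
        rcases ha with rfl | rfl | rfl <;> simp_all
      have h3 : ({i, j, k} : Finset (Fin t)).card = 3 :=
        Finset.card_eq_three.2 ⟨i, j, k, hji.symm, hk.1.symm, hk.2.symm, rfl⟩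
      have := (Finset.card_le_card hsub).trans (htwo ℓ)
      omega
    have h0 := hzero w
    rw [Fintype.sum_eq_add i j hji.symm (fun k hk => by rw [hoff k hk, mul_zero])] at h0
    simp only [LinearMap.smul_apply, smul_eq_mul]
    linear_combination h0
  choose! f hfI g hgf hf hg hfg using key
  rw [← Finset.card_sdiff_le_card_sdiff_iff]
  refine Finset.card_le_card_of_injOn (fun ℓ => q (g ℓ)) ?_ ?_
  · intro ℓ hℓ
    have hgI : g ℓ ∉ I := fun h =>
      hgf ℓ hℓ (hpar _ (hfI ℓ hℓ) _ h _ _ (hf ℓ hℓ) (hfg ℓ hℓ)).symm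
    have hxg : x (g ℓ) ≠ 0 := by
      intro h
      have h1 := hfg ℓ hℓ
      rw [h, smul_zero] at h1
      exact (smul_ne_zero (hf ℓ hℓ) (hne _ (hfI ℓ hℓ))) h1
    obtain ⟨w, hw⟩ : ∃ w, x (g ℓ) w ≠ 0 := by
      by_contra! h
      exact hxg (LinearMap.ext h)
    simp only [Finset.coe_sdiff, Set.mem_sdiff, Finset.mem_coe]
    refine ⟨mem_codeSupp.2 ⟨w, w.2, ?_⟩, ?_⟩
    · rw [hsum, Finset.sum_eq_single (g ℓ) (fun k _ hk => ?_) (by simp)]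
      · exact mul_ne_zero hw (mem_vsupp.1 (hq _))
      · have := hq' (g ℓ) k hk
        rw [mem_vsupp, not_not] at this
        rw [this, mul_zero]
    · rw [hU, Finset.mem_biUnion]
      rintro ⟨i, hi, hiq⟩
      exact hq' (g ℓ) i (fun h => hgI (h ▸ hi)) hiq
  · intro a ha b hb hab
    have hgg : g a = g b := by
      by_contra h
      refine hq' (g b) (g a) h ?_
      rw [← show q (g a) = q (g b) from hab]
      exact hq _
    have hff : f a = f b := by
      refine hpar _ (hfI a ha) _ (hfI b hb) (v (g b) b * v (f a) a) (v (g a) a * v (f b) b)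
        (mul_ne_zero (hg b hb) (hf a ha)) ?_
      rw [mul_smul, mul_smul, hfg a ha, hfg b hb, hgg, smul_smul, smul_smul]
      congr 1
      ring
    refine Finset.card_le_one.1 (hinter (f a) (g a) (hgf a ha).symm) a ?_ b ?_
    · exact Finset.mem_inter.2 ⟨mem_vsupp.2 (hf a ha), mem_vsupp.2 (hg a ha)⟩
    · rw [hff, hgg]
      exact Finset.mem_inter.2 ⟨mem_vsupp.2 (hf b hb), mem_vsupp.2 (hg b hb)⟩

/-- Lemma 5 of the paper: if a basis `v_1,…,v_t` of `D` has supports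
`R_i` that pairwise intersect in at most one coordinate, with each coordinate in at most
two of the `R_i`, and each `R_i` having a private coordinate, then
`d_m(D) = min_{|I|=m} |⋃_{i∈I} R_i|`. -/
theorem stmt13 {F : Type*} [Field F] {n t : ℕ}
    (D : Submodule F (Fin n → F)) (hD : Module.finrank F D = t)
    (v : Fin t → (Fin n → F)) (hli : LinearIndependent F v)
    (hspan : Submodule.span F (Set.range v) = D)
    (hinter : ∀ i j, i ≠ j → (vsupp (v i) ∩ vsupp (v j)).card ≤ 1)
    (htwo : ∀ ℓ : Fin n, (Finset.univ.filter (fun i => ℓ ∈ vsupp (v i))).card ≤ 2)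
    (hpriv : ∀ i, ∃ ℓ ∈ vsupp (v i), ∀ j, j ≠ i → ℓ ∉ vsupp (v j)) :
    ∀ m, 1 ≤ m → m ≤ t →
      ghw D m =
        sInf {c : ℕ | ∃ I : Finset (Fin t), I.card = m ∧
          (I.biUnion (fun i => vsupp (v i))).card = c} := by
  intro m _ hmt
  subst hspan
  have hsub (I : Finset (Fin t)) (hI : I.card = m) :
      ∃ E ≤ Submodule.span F (Set.range v), Module.finrank F E = m ∧
        (codeSupp E).card ≤ (I.biUnion (fun i => vsupp (v i))).card := by
    refine ⟨Submodule.span F (v '' I), Submodule.span_mono (Set.image_subset_range _ _), ?_,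
      Finset.card_le_card (codeSupp_span_image_subset v I)⟩
    have h := finrank_span_eq_card (hli.comp (Subtype.val : I → Fin t) Subtype.val_injective)
    rw [Set.range_comp, Subtype.range_coe_subtype] at h
    simpa [hI] using h
  obtain ⟨I₀, -, hI₀⟩ := Finset.exists_subset_card_eq
    (s := (Finset.univ : Finset (Fin t))) (n := m) (by simpa using hmt)
  obtain ⟨E₀, hE₀, hE₀m, -⟩ := hsub I₀ hI₀
  apply le_antisymm
  · obtain ⟨I, hI, hc⟩ := Nat.sInf_mem (s := {c : ℕ | ∃ I : Finset (Fin t), I.card = m ∧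
      (I.biUnion (fun i => vsupp (v i))).card = c}) ⟨_, I₀, hI₀, rfl⟩
    obtain ⟨E, hE, hEm, hle⟩ := hsub I hI
    rw [← hc]
    exact le_trans (Nat.sInf_le ⟨E, hE, hEm, rfl⟩) hle
  · refine le_csInf (Set.nonempty_of_mem ⟨E₀, hE₀, hE₀m, rfl⟩) ?_
    rintro _ ⟨E, hE, hEm, rfl⟩
    obtain ⟨I, hI, hle⟩ :=
      exists_card_biUnion_vsupp_le_card_codeSupp v hli hinter htwo hpriv E hE
    exact le_trans (Nat.sInf_le ⟨I, hI.trans hEm, rfl⟩) hle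
end

section
/- Let C be an [n,k] linear code over a field F with all-symbol locality r, i.e., for every coordinate i ∈ {1,…,n} there is a codeword of C^⊥ of Hamming weight at most r+1 whose support contains i. Let B0 be the subspace of C^⊥ spanned by all codewords of C^⊥ of Hamming weight at most r+1. Then dim(B0) ≥ n/(r+1). -/
/-- If vectors of weight at most `w` in a set `s` jointly cover all `n` coordinates, then
`n ≤ dim (span s) * w`. -/
theorem le_finrank_span_mul_of_covering {F : Type*} [Field F] {n w : ℕ} {s : Set (Fin n → F)}
    (hw : ∀ c ∈ s, (vsupp c).card ≤ w) (hs : ∀ i, ∃ c ∈ s, c i ≠ 0) :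
    n ≤ Module.finrank F (Submodule.span F s) * w := by
  classical
  obtain ⟨f, hf, hspan, -⟩ := Submodule.exists_fun_fin_finrank_span_eq F s
  have hcover : ∀ i : Fin n, ∃ j, f j i ≠ 0 := by
    intro i
    by_contra! hzero
    obtain ⟨c, hc, hci⟩ := hs i
    have hle : Submodule.span F (Set.range f) ≤
        LinearMap.ker (LinearMap.proj i : (Fin n → F) →ₗ[F] F) := by
      rw [Submodule.span_le]
      rintro _ ⟨j, rfl⟩
      exact hzero j
    exact hci (hle (hspan.symm.le (Submodule.subset_span hc)))
  calc n = (Finset.univ : Finset (Fin n)).card := by simp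
    _ ≤ (Finset.univ.biUnion fun j => vsupp (f j)).card :=
      Finset.card_le_card fun i _ => by simpa [vsupp] using hcover i
    _ ≤ Finset.univ.card * w := Finset.card_biUnion_le_card_mul _ _ _ fun j _ => hw _ (hf j)
    _ = Module.finrank F (Submodule.span F s) * w := by simp

/-- for a code with all-symbol locality `r`, the span `B0` of
dual codewords of weight `≤ r+1` satisfies `dim B0 ≥ n/(r+1)`. -/
theorem stmt14 {F : Type*} [Field F] {n k r : ℕ} (hr : 1 ≤ r)
    (C : Submodule F (Fin n → F)) (hC : Module.finrank F C = k)
    (hloc : ∀ i : Fin n, ∃ c ∈ dualCode C, (vsupp c).card ≤ r + 1 ∧ c i ≠ 0) :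
    (n : ℚ) / (r + 1) ≤ (Module.finrank F (lowWtSpan C r) : ℚ) := by
  have hle : n ≤ Module.finrank F (lowWtSpan C r) * (r + 1) :=
    le_finrank_span_mul_of_covering (fun c hc => hc.2) fun i =>
      let ⟨c, hc, hcard, hci⟩ := hloc i
      ⟨c, ⟨hc, hcard⟩, hci⟩
  rw [div_le_iff₀ (by positivity)]
  exact_mod_cast hle
end
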